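/- The Euler–Lagrange expression of a k-th order Lagrangian is an affine function of the highest variable q_{2k}: identically in (q₀,…,q_{2k}), [L] = α − (−1)^{k−1} W(q₀,…,q_k) q_{2k}, where α is the ℝⁿ-valued function of (q₀,…,q_{2k−1}) given componentwise by α_a = (∂L/∂q₀)_a − Σ_{j=0}^{2k−2} Σ_b (∂p̂⁰_a/∂q_j^b) q_{j+1}^b. In particular, the partial Jacobian of [L] with respect to q_{2k} equals (−1)^k W at every point. -/

import Mathlib

open scoped BigOperators

noncomputable section

/-- `Vec n` is `ℝⁿ`. -/
abbrev Vec (n : ℕ) := Fin n → ℝ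

/-- `Jet n m` packages the variables `q₀, …, q_m`, each a vector of `ℝⁿ`. -/
abbrev Jet (n m : ℕ) := Fin (m+1) → Vec n

/-- The standard inner product on `ℝⁿ`. -/
def dot {n : ℕ} (u v : Vec n) : ℝ := ∑ a, u a * v a

/-- Forget the top variable `q_{m+1}`. -/
def res {n m : ℕ} (q : Jet n (m+1)) : Jet n m := fun i => q i.castSucc

/-- The shift `(shft q) i = q (i+1)`. -/
def shft {n m : ℕ} (q : Jet n (m+1)) : Jet n m := fun i => q i.succ

/-- Restriction of a jet to a lower-order jet. -/
def trunc {n m m' : ℕ} (h : m' ≤ m) (q : Jet n m) : Jet n m' :=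
  fun i => q (Fin.castLE (Nat.succ_le_succ h) i)

/-- The partial gradient of `f` in the slot `q_i`, identified with a vector of `ℝⁿ`
via the standard inner product (i.e. the vector representing the partial
differential `∂f/∂q_i`). -/
def gradSlot {n m : ℕ} (f : Jet n m → ℝ) (q : Jet n m) (i : Fin (m+1)) : Vec n :=
  fun a => fderiv ℝ f q (Pi.single i (Pi.single a 1))

/-- The formal total time derivative of a time-independent function
`f(q₀,…,q_m)`: `D_t f = Σ_i (∂f/∂q_i)·q_{i+1}`, a function of `(q₀,…,q_{m+1})`. -/
def Dt0 {n m : ℕ} {F : Type*} [NormedAddCommGroup F] [NormedSpace ℝ F]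
    (f : Jet n m → F) (q : Jet n (m+1)) : F :=
  fderiv ℝ f (res q) (shft q)

/-- Iterated formal total time derivative (time-independent functions). -/
def DtIter0 {n m : ℕ} {F : Type*} [NormedAddCommGroup F] [NormedSpace ℝ F] :
    (r : ℕ) → (Jet n m → F) → (Jet n (m + r) → F)
  | 0, f => f
  | r+1, f => Dt0 (DtIter0 r f)

/-- The formal total time derivative of a time-dependent function
`f(t,q₀,…,q_m)`: `D_t f = ∂f/∂t + Σ_i (∂f/∂q_i)·q_{i+1}`. -/
def Dt {n m : ℕ} {F : Type*} [NormedAddCommGroup F] [NormedSpace ℝ F]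
    (f : ℝ × Jet n m → F) (x : ℝ × Jet n (m+1)) : F :=
  fderiv ℝ f (x.1, res x.2) (1, shft x.2)

/-- Iterated formal total time derivative (time-dependent functions). -/
def DtIter {n m : ℕ} {F : Type*} [NormedAddCommGroup F] [NormedSpace ℝ F] :
    (r : ℕ) → (ℝ × Jet n m → F) → (ℝ × Jet n (m + r) → F)
  | 0, f => f
  | r+1, f => Dt (DtIter r f)

/-- The partial gradient in the slot `q_i` of a time-dependent function. -/
def gradSlotT {n m : ℕ} (f : ℝ × Jet n m → ℝ) (x : ℝ × Jet n m) (i : Fin (m+1)) : Vec n :=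
  fun a => fderiv ℝ f x (0, Pi.single i (Pi.single a 1))

/-- The Ostrogradskii momenta of a Lagrangian `L(q₀,…,q_{k+1})` of order `k+1`:
`mom L j` is the momentum `p̂^{k-j}`, a function of `(q₀,…,q_{k+j+1})`.
It is defined by the downward recursion `p̂^{k} = ∂L/∂q_{k+1}` and
`p̂^{i-1} = ∂L/∂q_i − D_t p̂^i`. -/
def mom {n k : ℕ} (L : Jet n (k+1) → ℝ) : (j : ℕ) → (Jet n (k + j + 1) → Vec n)
  | 0 => fun q => gradSlot L q (Fin.last (k+1))
  | j+1 => fun q =>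
      gradSlot L (trunc (by omega) q) ⟨k - j, by omega⟩ - Dt0 (mom L j) q

/-- The Euler–Lagrange expression `[L] = Σ_{r=0}^{k+1} (−1)^r D_t^r (∂L/∂q_r)`
of a Lagrangian of order `k+1`, a function of `(q₀,…,q_{2(k+1)})`. -/
def EL {n k : ℕ} (L : Jet n (k+1) → ℝ) (q : Jet n (k+k+2)) : Vec n :=
  ∑ r : Fin (k+2),
    ((-1 : ℝ)) ^ (r : ℕ) •
      DtIter0 (r : ℕ) (fun q' => gradSlot L q' r)
        (trunc (by have := r.isLt; omega) q)

/-- The Hessian `W = ∂²L/∂q_{k+1}∂q_{k+1}` of a Lagrangian of order `k+1`,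
as an operator `ℝⁿ → ℝⁿ` (a function of `(q₀,…,q_{k+1})`). -/
def hessOp {n k : ℕ} (L : Jet n (k+1) → ℝ) (q : Jet n (k+1)) (v : Vec n) : Vec n :=
  fun a => fderiv ℝ (fun q' => gradSlot L q' (Fin.last (k+1)) a) q
    (Pi.single (Fin.last (k+1)) v)

/-- The first partial Legendre–Ostrogradskii transformation
`F₀ : (q₀,…,q_{2k+1}) ↦ (q₀,…,q_{2k}; p̂⁰)`. -/
def F0 {n k : ℕ} (L : Jet n (k+1) → ℝ) (q : Jet n (k+k+1)) : Jet n (k+k) × Vec n :=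
  (res q, mom L k q)

/-- Pull-back through `F₀` of a (time-dependent) function on the intermediate
space `P₁`. -/
def pullF0 {n k : ℕ} {F : Type*} (L : Jet n (k+1) → ℝ)
    (g : ℝ × (Jet n (k+k) × Vec n) → F) (x : ℝ × Jet n (k+k+1)) : F :=
  g (x.1, F0 L x.2)

/-- The intermediate evolution operator `K₀`:
`K₀·g = (∂g/∂t)∘F₀ + Σ_{i=0}^{2k} ((∂g/∂q_i)∘F₀)·q_{i+1} + ((∂g/∂p⁰)∘F₀)·(∂L/∂q₀)`. -/
def K0 {n k : ℕ} {F : Type*} [NormedAddCommGroup F] [NormedSpace ℝ F]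
    (L : Jet n (k+1) → ℝ)
    (g : ℝ × (Jet n (k+k) × Vec n) → F) (x : ℝ × Jet n (k+k+1)) : F :=
  fderiv ℝ g (x.1, F0 L x.2)
    (1, shft x.2, gradSlot L (trunc (by omega) x.2) 0)

/-- The partial gradient `∂g/∂p⁰` of a function on `P₁`, as a vector of `ℝⁿ`. -/
def gradMom {n k : ℕ} (g : ℝ × (Jet n (k+k) × Vec n) → ℝ)
    (x : ℝ × (Jet n (k+k) × Vec n)) : Vec n :=
  fun a => fderiv ℝ g x (0, 0, Pi.single a 1)

/-- The function `α` of `(q₀,…,q_{2k+1})`, given componentwise by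
`α_a = (∂L/∂q₀)_a − Σ_{j=0}^{2k} Σ_b (∂p̂⁰_a/∂q_j^b) q_{j+1}^b`. -/
def alphaFn {n k : ℕ} (L : Jet n (k+1) → ℝ) (q : Jet n (k+k+1)) : Vec n :=
  fun a =>
    gradSlot L (trunc (by omega) q) 0 a -
      ∑ j : Fin (k+k+1),
        fderiv ℝ (fun q' => mom L k q' a) q (Pi.single j.castSucc (q j.succ))

section Lemmas

open ContDiff

variable {n : ℕ}

/-- `trunc` as a continuous linear map. -/
def truncL {m m' : ℕ} (h : m' ≤ m) : Jet n m →L[ℝ] Jet n m' :=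
  ContinuousLinearMap.pi fun i =>
    ContinuousLinearMap.proj (Fin.castLE (Nat.succ_le_succ h) i)

/-- `res` as a continuous linear map. -/
def resL (n m : ℕ) : Jet n (m+1) →L[ℝ] Jet n m :=
  ContinuousLinearMap.pi fun i => ContinuousLinearMap.proj i.castSucc

/-- `shft` as a continuous linear map. -/
def shftL (n m : ℕ) : Jet n (m+1) →L[ℝ] Jet n m :=
  ContinuousLinearMap.pi fun i => ContinuousLinearMap.proj i.succ

lemma trunc_single_last {m m' : ℕ} (h : m' < m) (v : Vec n) :
    trunc h.le (Pi.single (Fin.last m) v : Jet n m) = 0 := by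
  funext i
  have : Fin.castLE (Nat.succ_le_succ h.le) i ≠ Fin.last m := by
    intro e
    have := congrArg Fin.val e
    simp at this
    omega
  simp [trunc, Pi.single_eq_of_ne this]

lemma res_single_last {m : ℕ} (v : Vec n) :
    res (Pi.single (Fin.last (m+1)) v : Jet n (m+1)) = 0 := by
  funext i
  simp [res]

lemma shft_single_last {m : ℕ} (v : Vec n) :
    shft (Pi.single (Fin.last (m+1)) v : Jet n (m+1)) = Pi.single (Fin.last m) v := by
  funext i
  rcases eq_or_ne i (Fin.last m) with rfl | hi
  · simp [shft]
  · have : i.succ ≠ Fin.last (m+1) := by simpa [← Fin.succ_last] using hi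
    simp [shft, Pi.single_eq_of_ne this, Pi.single_eq_of_ne hi]

section Smooth

variable {F : Type*} [NormedAddCommGroup F] [NormedSpace ℝ F]

lemma contDiff_comp_trunc {m m' : ℕ} (h : m' ≤ m) {f : Jet n m' → F} (hf : ContDiff ℝ ∞ f) :
    ContDiff ℝ ∞ fun q : Jet n m => f (trunc h q) :=
  hf.comp (truncL h).contDiff

lemma contDiff_fderiv_infty {E : Type*} [NormedAddCommGroup E] [NormedSpace ℝ E]
    {f : E → F} (hf : ContDiff ℝ ∞ f) : ContDiff ℝ ∞ (fderiv ℝ f) :=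
  hf.fderiv_right (by simp)

lemma contDiff_Dt0 {m : ℕ} {f : Jet n m → F} (hf : ContDiff ℝ ∞ f) : ContDiff ℝ ∞ (Dt0 f) :=
  ((contDiff_fderiv_infty hf).comp (resL n m).contDiff).clm_apply (shftL n m).contDiff

lemma contDiff_DtIter0 {m : ℕ} {f : Jet n m → F} (hf : ContDiff ℝ ∞ f) (r : ℕ) :
    ContDiff ℝ ∞ (DtIter0 r f) := by
  induction r with
  | zero => exact hf
  | succ r ih => exact contDiff_Dt0 ih

lemma contDiff_gradSlot {m : ℕ} {f : Jet n m → ℝ} (hf : ContDiff ℝ ∞ f) (i : Fin (m+1)) :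
    ContDiff ℝ ∞ fun q => gradSlot f q i :=
  contDiff_pi.2 fun _ => (contDiff_fderiv_infty hf).clm_apply contDiff_const

lemma contDiff_mom {k : ℕ} {L : Jet n (k+1) → ℝ} (hL : ContDiff ℝ ∞ L) (j : ℕ) :
    ContDiff ℝ ∞ (mom L j) := by
  induction j with
  | zero => exact contDiff_gradSlot hL _
  | succ j ih =>
    exact (contDiff_comp_trunc (by omega) (contDiff_gradSlot hL _)).sub (contDiff_Dt0 ih)

lemma fderiv_comp_trunc {m m' : ℕ} (h : m' ≤ m) {f : Jet n m' → F}
    (hf : Differentiable ℝ f) (q v : Jet n m) :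
    fderiv ℝ (fun q' => f (trunc h q')) q v = fderiv ℝ f (trunc h q) (trunc h v) := by
  have := (hf (trunc h q)).hasFDerivAt.comp q (truncL h).hasFDerivAt
  exact congrArg (· v) this.fderiv

lemma Dt0_comp_trunc {m m' : ℕ} (h : m' ≤ m) {f : Jet n m' → F}
    (hf : Differentiable ℝ f) (q : Jet n (m+1)) :
    Dt0 (fun q' => f (trunc h q')) q = Dt0 f (trunc (Nat.succ_le_succ h) q) :=
  fderiv_comp_trunc h hf _ _

lemma Dt0_sum_smul {ι : Type*} {m : ℕ} (s : Finset ι) (c : ι → ℝ) {f : ι → Jet n m → F}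
    (hf : ∀ i, Differentiable ℝ (f i)) (q : Jet n (m+1)) :
    Dt0 (fun q' => ∑ i ∈ s, c i • f i q') q = ∑ i ∈ s, c i • Dt0 (f i) q := by
  have h := HasFDerivAt.fun_sum (u := s) fun i _ =>
    ((hf i) (res q)).hasFDerivAt.fun_const_smul (c i)
  refine (congrArg (· (shft q)) h.fderiv).trans ?_
  simp [Dt0]

/-- Only the top variable of `f` contributes to the dependence of `D_t f` on its top variable. -/
lemma fderiv_Dt0_single_last {m : ℕ} {f : Jet n m → F} (hf : ContDiff ℝ ∞ f)
    (q : Jet n (m+1)) (v : Vec n) :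
    fderiv ℝ (Dt0 f) q (Pi.single (Fin.last (m+1)) v) =
      fderiv ℝ f (res q) (Pi.single (Fin.last m) v) := by
  have h1 : HasFDerivAt (fun q' : Jet n (m+1) => fderiv ℝ f (res q'))
      ((fderiv ℝ (fderiv ℝ f) (res q)).comp (resL n m)) q :=
    (((contDiff_fderiv_infty hf).differentiable (by simp)) (res q)).hasFDerivAt.comp q
      (resL n m).hasFDerivAt
  have h2 := h1.clm_apply (shftL n m).hasFDerivAt
  have h3 := congrArg (· (Pi.single (Fin.last (m+1)) v)) h2.fderiv
  have hr : resL n m (Pi.single (Fin.last (m+1)) v) = 0 := res_single_last v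
  have hs : shftL n m (Pi.single (Fin.last (m+1)) v) = Pi.single (Fin.last m) v :=
    shft_single_last v
  refine h3.trans ?_
  simp [hr, hs]

end Smooth

lemma fderiv_component_apply {E : Type*} [NormedAddCommGroup E] [NormedSpace ℝ E]
    {f : E → Vec n} {x : E} (hf : DifferentiableAt ℝ f x) (a : Fin n) (v : E) :
    fderiv ℝ (fun y => f y a) x v = fderiv ℝ f x v a :=
  congrArg (· v) (fderiv_apply hf a)

/-- The momenta as alternating sums of iterated total derivatives of the partial gradients. -/
lemma mom_eq_sum {k : ℕ} {L : Jet n (k+1) → ℝ} (hL : ContDiff ℝ ∞ L) (j : ℕ) (hj : j ≤ k + 1)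
    (q : Jet n (k + j + 1)) :
    mom L j q = ∑ s : Fin (j+1), ((-1 : ℝ)) ^ (s : ℕ) •
      DtIter0 (s : ℕ) (fun q' => gradSlot L q' ⟨k + 1 - j + s, by omega⟩)
        (trunc (by omega) q) := by
  induction j with
  | zero =>
    simp only [Nat.reduceAdd, Finset.univ_unique, Fin.default_eq_zero, Finset.sum_singleton]
    simp [mom, DtIter0]
    rfl
  | succ j ih =>
    have hm : mom L j = fun q => ∑ s : Fin (j+1), ((-1 : ℝ)) ^ (s : ℕ) •
        DtIter0 (s : ℕ) (fun q' => gradSlot L q' ⟨k + 1 - j + s, by omega⟩)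
          (trunc (by omega) q) := funext (ih (by omega))
    have hd : ∀ s : Fin (j+1), Differentiable ℝ
        (DtIter0 (s : ℕ) (fun q' => gradSlot L q' ⟨k + 1 - j + s, by omega⟩)) :=
      fun s => (contDiff_DtIter0 (contDiff_gradSlot hL _) _).differentiable (by simp)
    have hD : Dt0 (mom L j) q = ∑ s : Fin (j+1), ((-1 : ℝ)) ^ (s : ℕ) •
        Dt0 (DtIter0 (s : ℕ) (fun q' => gradSlot L q' ⟨k + 1 - j + s, by omega⟩))
          (trunc (by omega) q) := by
      rw [hm]
      refine (Dt0_sum_smul _ _ (fun s => (hd s).comp (truncL (by omega)).differentiable) q).trans ?_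
      exact Finset.sum_congr rfl fun s _ => congrArg _
        (Dt0_comp_trunc (m := k + j + 1) (by omega) (hd s) q)
    have hrec : mom L (j+1) q =
      gradSlot L (trunc (by omega) q) ⟨k - j, by omega⟩ - Dt0 (mom L j) q := rfl
    rw [Fin.sum_univ_succ, hrec, hD, sub_eq_add_neg, ← Finset.sum_neg_distrib]
    congr 1
    · simp only [Fin.val_zero, pow_zero, one_smul, DtIter0]
      congr 2
      simp
    · refine Finset.sum_congr rfl fun s _ => ?_
      have hi : k + 1 - j + (s : ℕ) = k + 1 - (j + 1) + (s.succ : ℕ) := by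
        simp only [Fin.val_succ]; omega
      rw [← neg_smul]
      simp only [hi, Fin.val_succ, DtIter0, pow_succ, mul_neg, mul_one]

lemma EL_eq_mom {k : ℕ} {L : Jet n (k+1) → ℝ} (hL : ContDiff ℝ ∞ L) :
    EL L = mom L (k+1) := by
  funext q
  rw [mom_eq_sum hL (k+1) le_rfl]
  refine Finset.sum_congr rfl fun s _ => ?_
  simp

/-- The partial Jacobian of a momentum in its top variable is the Hessian up to sign. -/
lemma fderiv_mom_single_last {k : ℕ} {L : Jet n (k+1) → ℝ} (hL : ContDiff ℝ ∞ L) (j : ℕ)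
    (q : Jet n (k + j + 1)) (v : Vec n) :
    fderiv ℝ (mom L j) q (Pi.single (Fin.last (k + j + 1)) v) =
      ((-1 : ℝ)) ^ j • hessOp L (trunc (by omega) q) v := by
  induction j with
  | zero =>
    funext a
    simp only [pow_zero, one_smul, hessOp]
    exact (fderiv_component_apply (((contDiff_mom hL 0).differentiable (by simp)) q) a _).symm
  | succ j ih =>
    have hg := contDiff_gradSlot hL (⟨k - j, by omega⟩ : Fin (k + 1 + 1))
    have h1 := (contDiff_comp_trunc (m := k + (j+1) + 1) (by omega) hg).differentiable (by simp) q
    have h2 := (contDiff_Dt0 (contDiff_mom hL j)).differentiable (by simp) q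
    have h3 := congrArg (· (Pi.single (Fin.last (k + (j+1) + 1)) v)) (fderiv_fun_sub h1 h2)
    refine h3.trans ?_
    rw [sub_apply, fderiv_comp_trunc _ (hg.differentiable (by simp)),
      trunc_single_last (by omega), map_zero, zero_sub]
    erw [fderiv_Dt0_single_last (contDiff_mom hL j), ih]
    rw [pow_succ, mul_neg_one, neg_smul]
    rfl

lemma sum_single_castSucc_add_single_last {m : ℕ} (w : Jet n (m+1)) :
    w = (∑ j : Fin (m+1), Pi.single j.castSucc (w j.castSucc)) +
      Pi.single (Fin.last (m+1)) (w (Fin.last (m+1))) := by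
  conv_lhs => rw [← Finset.univ_sum_single w, Fin.sum_univ_castSucc]

end Lemmas

/-- the paper's relation (4).
The Euler–Lagrange expression is affine in the top variable `q_{2(k+1)}`:
`[L] = α − (−1)^{(k+1)−1} W q_{2(k+1)}`, and consequently the partial Jacobian
of `[L]` with respect to `q_{2(k+1)}` is `(−1)^{k+1} W` at every point. -/
theorem EL_affine_in_top_velocity
    (n k : ℕ) (hn : 1 ≤ n)
    (L : Jet n (k+1) → ℝ) (hL : ContDiff ℝ (⊤ : ℕ∞) L) :
    ∀ q : Jet n (k+k+2),
      (EL L q = alphaFn L (res q) -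
          ((-1 : ℝ)) ^ k • hessOp L (trunc (by omega) q) (q (Fin.last (k+k+2)))) ∧
      ∀ v : Vec n,
        fderiv ℝ (EL L) q (Pi.single (Fin.last (k+k+2)) v) =
          ((-1 : ℝ)) ^ (k+1) • hessOp L (trunc (by omega) q) v := by
  intro q
  rw [EL_eq_mom hL]
  refine ⟨?_, fderiv_mom_single_last hL (k+1) q⟩
  have hs : Dt0 (mom L k) q =
      (∑ j : Fin (k+k+1), fderiv ℝ (mom L k) (res q) (Pi.single j.castSucc (res q j.succ))) +
        ((-1 : ℝ)) ^ k • hessOp L (trunc (by omega) q) (q (Fin.last (k+k+2))) := by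
    rw [Dt0, sum_single_castSucc_add_single_last (shft q), map_add, map_sum,
      fderiv_mom_single_last hL]
    rfl
  funext a
  have hd := ((contDiff_mom hL k).differentiable (by simp)) (res q)
  have hm : mom L (k+1) q a = gradSlot L (trunc (by omega) q) ⟨k - k, by omega⟩ a -
      Dt0 (mom L k) q a := rfl
  have hα : alphaFn L (res q) a = gradSlot L (trunc (by omega) (res q)) 0 a -
      ∑ j : Fin (k+k+1), fderiv ℝ (fun q' => mom L k q' a) (res q)
        (Pi.single j.castSucc (res q j.succ)) := rfl
  rw [hm, hs, Pi.sub_apply, hα, Pi.add_apply, Finset.sum_apply, ← sub_sub]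
  simp only [fderiv_component_apply hd a, Nat.sub_self]
  rfl

end
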